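/- arXiv:0712.2891 — 2 statements merged into one kernel-verified Lean document; each statement's English description precedes it below -/
import Mathlib

section
/- Let m = 3 and let A₀ = (a⁰_{ij}), A₁ = (a¹_{ij}) be transversal real skew-symmetric 3×3 matrices with entries of absolute value ≤ 1 (transversality here means all off-diagonal entries are nonzero). Then V_{A₀} and V_{A₁} are homotopic if and only if corresponding entries have the same sign: a⁰_{ij} · a¹_{ij} > 0 for all 1 ≤ i < j ≤ 3. -/
open Matrix

/-- A matrix defining a Volterra quadratic stochastic operator:
skew-symmetric with entries of absolute value at most 1. -/
def IsQSOMatrix {n : Type*} [Fintype n] (A : Matrix n n ℝ) : Prop :=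
  Aᵀ = -A ∧ ∀ i j, |A i j| ≤ 1

/-- The Volterra quadratic stochastic operator associated to a matrix `A`:
`(V_A x)_k = x_k (1 + ∑ i, a_{k i} x_i)`. -/
noncomputable def volterra {n : Type*} [Fintype n] (A : Matrix n n ℝ) (x : n → ℝ) : n → ℝ :=
  fun k => x k * (1 + ∑ i, A k i * x i)

/-- The set of fixed points of `V_A` in the standard simplex. -/
def FixSet {n : Type*} [Fintype n] (A : Matrix n n ℝ) : Set (n → ℝ) :=
  {x ∈ stdSimplex ℝ n | volterra A x = x}

/-- A skew-symmetric matrix is transversal if every principal submatrix on an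
evenly-sized index set has nonzero determinant. -/
def IsTransversal {n : Type*} [Fintype n] [DecidableEq n] (A : Matrix n n ℝ) : Prop :=
  ∀ s : Finset n, Even s.card →
    (A.submatrix (fun i : s => (i : n)) (fun i : s => (i : n))).det ≠ 0

/-- Two (transversal) Volterra operators are homotopic if they are joined by a
continuous family of transversal Volterra matrices along which the number of
fixed points is constant. -/
def QSOHomotopic {n : Type*} [Fintype n] [DecidableEq n] (A₀ A₁ : Matrix n n ℝ) : Prop :=
  ∃ A : ℝ → Matrix n n ℝ,
    ContinuousOn A (Set.Icc 0 1) ∧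
    A 0 = A₀ ∧ A 1 = A₁ ∧
    (∀ t ∈ Set.Icc (0:ℝ) 1, IsQSOMatrix (A t) ∧ IsTransversal (A t)) ∧
    (∀ t ∈ Set.Icc (0:ℝ) 1, (FixSet (A t)).ncard = (FixSet A₀).ncard) ∧
    (FixSet A₀).ncard = (FixSet A₁).ncard

/-- A Volterra matrix is skew-symmetric entrywise. -/
lemma IsQSOMatrix.apply_swap {n : Type*} [Fintype n] {A : Matrix n n ℝ} (hA : IsQSOMatrix A)
    (i j : n) : A j i = -A i j := congrFun (congrFun hA.1 i) j

lemma IsQSOMatrix.apply_self {n : Type*} [Fintype n] {A : Matrix n n ℝ} (hA : IsQSOMatrix A)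
    (i : n) : A i i = 0 := by
  linarith [hA.apply_swap i i]

/-- The principal minor of a skew-symmetric matrix on a pair `{i, j}` is `(A i j) ^ 2`. -/
lemma IsQSOMatrix.det_pair {n : Type*} [Fintype n] [DecidableEq n] {A : Matrix n n ℝ}
    (hA : IsQSOMatrix A) {i j : n} (hij : i ≠ j) :
    (A.submatrix (fun k : ({i, j} : Finset n) => (k : n))
      (fun k : ({i, j} : Finset n) => (k : n))).det = A i j ^ 2 := by
  let f : Fin 2 → ({i, j} : Finset n) := ![⟨i, by simp⟩, ⟨j, by simp⟩]
  have hf : Function.Bijective f := by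
    constructor
    · intro a b hab
      fin_cases a <;> fin_cases b <;> simp_all [f]
    · rintro ⟨k, hk⟩
      rcases Finset.mem_insert.1 hk with rfl | hk
      · exact ⟨0, rfl⟩
      · obtain rfl := Finset.mem_singleton.1 hk
        exact ⟨1, rfl⟩
  rw [← Matrix.det_submatrix_equiv_self (Equiv.ofBijective f hf), Matrix.det_fin_two]
  simp only [Matrix.submatrix_apply, Equiv.ofBijective_apply, f, Matrix.cons_val_zero,
    Matrix.cons_val_one]
  rw [hA.apply_self, hA.apply_swap i j]
  ring

/-- In dimension three, transversality means that the off-diagonal entries do not vanish. -/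
lemma IsQSOMatrix.isTransversal_iff {A : Matrix (Fin 3) (Fin 3) ℝ} (hA : IsQSOMatrix A) :
    IsTransversal A ↔ ∀ i j, i < j → A i j ≠ 0 := by
  constructor
  · intro h i j hij h0
    refine h {i, j} (by rw [Finset.card_pair hij.ne]; exact even_two) ?_
    rw [hA.det_pair hij.ne, h0]
    norm_num
  · intro h s hs
    have hcard : s.card ≤ 3 := by simpa using s.card_le_univ
    have hcases : s.card = 0 ∨ s.card = 2 := by
      obtain ⟨k, hk⟩ := hs
      omega
    rcases hcases with h0 | h2
    · obtain rfl := Finset.card_eq_zero.1 h0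
      rw [Matrix.det_isEmpty]
      exact one_ne_zero
    · obtain ⟨i, j, hij, rfl⟩ := Finset.card_eq_two.1 h2
      rw [hA.det_pair hij]
      refine pow_ne_zero 2 ?_
      rcases lt_or_gt_of_ne hij with hlt | hgt
      · exact h i j hlt
      · rw [hA.apply_swap j i]
        exact neg_ne_zero.2 (h j i hgt)

lemma volterra_eq_self_iff {n : Type*} [Fintype n] (A : Matrix n n ℝ) (x : n → ℝ) :
    volterra A x = x ↔ ∀ k, x k * ∑ i, A k i * x i = 0 := by
  rw [funext_iff]
  refine forall_congr' fun k => ?_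
  rw [volterra, mul_add, mul_one, add_eq_left]

/-- The projective rescaling of the simplex with weights `w`. -/
noncomputable def simplexRescale {n : Type*} [Fintype n] (w x : n → ℝ) : n → ℝ :=
  fun i => w i * x i / ∑ j, w j * x j

section simplexRescale

variable {n : Type*} [Fintype n] {w x : n → ℝ}

lemma sum_weight_mul_pos (hw : ∀ i, 0 < w i) (hx : x ∈ stdSimplex ℝ n) :
    0 < ∑ j, w j * x j := by
  have hnonneg : ∀ j ∈ Finset.univ, 0 ≤ w j * x j :=
    fun j _ => mul_nonneg (hw j).le (hx.1 j)
  refine (Finset.sum_nonneg hnonneg).lt_of_ne fun h => ?_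
  have hzero : ∀ j, x j = 0 := fun j =>
    (mul_eq_zero.1 ((Finset.sum_eq_zero_iff_of_nonneg hnonneg).1 h.symm j
      (Finset.mem_univ j))).resolve_left (hw j).ne'
  have hsum := hx.2
  simp [hzero] at hsum

lemma simplexRescale_mem (hw : ∀ i, 0 < w i) (hx : x ∈ stdSimplex ℝ n) :
    simplexRescale w x ∈ stdSimplex ℝ n := by
  have hpos := sum_weight_mul_pos hw hx
  refine ⟨fun i => div_nonneg (mul_nonneg (hw i).le (hx.1 i)) hpos.le, ?_⟩
  simp only [simplexRescale]
  rw [← Finset.sum_div, div_self hpos.ne']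

lemma simplexRescale_inv (hw : ∀ i, 0 < w i) (hx : x ∈ stdSimplex ℝ n) :
    simplexRescale w⁻¹ (simplexRescale w x) = x := by
  have hpos := sum_weight_mul_pos hw hx
  have hcoord : ∀ i, w⁻¹ i * simplexRescale w x i = x i / ∑ j, w j * x j := fun i => by
    have := (hw i).ne'
    simp only [simplexRescale, Pi.inv_apply]
    field_simp
  funext i
  rw [simplexRescale]
  simp only [hcoord]
  rw [← Finset.sum_div, hx.2]
  field_simp

end simplexRescale

/-- The weights carrying fixed points of `A` to fixed points of `B`. -/
noncomputable def fixWeight (A B : Matrix (Fin 3) (Fin 3) ℝ) : Fin 3 → ℝ :=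
  ![B 1 2 / A 1 2, B 0 2 / A 0 2, B 0 1 / A 0 1]

lemma fixWeight_pos {A B : Matrix (Fin 3) (Fin 3) ℝ}
    (h : ∀ i j : Fin 3, i < j → 0 < A i j * B i j) (k : Fin 3) : 0 < fixWeight A B k := by
  have hdiv : ∀ i j : Fin 3, i < j → 0 < B i j / A i j := fun i j hij => by
    rw [div_pos_iff]
    rcases mul_pos_iff.1 (h i j hij) with ⟨ha, hb⟩ | ⟨ha, hb⟩
    · exact Or.inl ⟨hb, ha⟩
    · exact Or.inr ⟨hb, ha⟩
  fin_cases k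
  · exact hdiv 1 2 (by decide)
  · exact hdiv 0 2 (by decide)
  · exact hdiv 0 1 (by decide)

lemma fixWeight_inv (A B : Matrix (Fin 3) (Fin 3) ℝ) : (fixWeight A B)⁻¹ = fixWeight B A := by
  funext k
  fin_cases k <;> simp [fixWeight]

lemma mapsTo_simplexRescale_fixSet {A B : Matrix (Fin 3) (Fin 3) ℝ} (hA : IsQSOMatrix A)
    (hB : IsQSOMatrix B) (h : ∀ i j : Fin 3, i < j → 0 < A i j * B i j) :
    Set.MapsTo (simplexRescale (fixWeight A B)) (FixSet A) (FixSet B) := by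
  rintro x ⟨hx, hfix⟩
  refine ⟨simplexRescale_mem (fixWeight_pos h) hx, ?_⟩
  rw [volterra_eq_self_iff] at hfix ⊢
  have hne : ∀ i j : Fin 3, i < j → A i j ≠ 0 := fun i j hij =>
    left_ne_zero_of_mul (h i j hij).ne'
  have h01 := hne 0 1 (by decide)
  have h02 := hne 0 2 (by decide)
  have h12 := hne 1 2 (by decide)
  have hf0 := hfix 0
  have hf1 := hfix 1
  have hf2 := hfix 2
  simp only [Fin.sum_univ_three, hA.apply_self, hA.apply_swap 0 1, hA.apply_swap 0 2,
    hA.apply_swap 1 2] at hf0 hf1 hf2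
  have hb01 : B 0 1 = fixWeight A B 2 * A 0 1 := (div_mul_cancel₀ _ h01).symm
  have hb02 : B 0 2 = fixWeight A B 1 * A 0 2 := (div_mul_cancel₀ _ h02).symm
  have hb12 : B 1 2 = fixWeight A B 0 * A 1 2 := (div_mul_cancel₀ _ h12).symm
  intro k
  simp only [simplexRescale]
  generalize ∑ j, fixWeight A B j * x j = S
  generalize fixWeight A B = w at *
  rw [Fin.sum_univ_three]
  fin_cases k
  · simp only [Fin.zero_eta, hB.apply_self, hb01, hb02]
    linear_combination w 0 * w 1 * w 2 / S ^ 2 * hf0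
  · simp only [Fin.mk_one, hB.apply_self, hB.apply_swap 0 1, hb01, hb12]
    linear_combination w 0 * w 1 * w 2 / S ^ 2 * hf1
  · simp only [Fin.reduceFinMk, hB.apply_self, hB.apply_swap 0 2, hB.apply_swap 1 2, hb02, hb12]
    linear_combination w 0 * w 1 * w 2 / S ^ 2 * hf2

/-- Volterra matrices with the same sign pattern have equally many fixed points. -/
lemma ncard_fixSet_eq {A B : Matrix (Fin 3) (Fin 3) ℝ} (hA : IsQSOMatrix A)
    (hB : IsQSOMatrix B) (h : ∀ i j : Fin 3, i < j → 0 < A i j * B i j) :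
    (FixSet A).ncard = (FixSet B).ncard := by
  have h' : ∀ i j : Fin 3, i < j → 0 < B i j * A i j := fun i j hij => by
    rw [mul_comm]
    exact h i j hij
  have hinv : Set.InvOn (simplexRescale (fixWeight B A)) (simplexRescale (fixWeight A B))
      (FixSet A) (FixSet B) := by
    refine ⟨fun x hx => ?_, fun x hx => ?_⟩
    · rw [← fixWeight_inv A B]
      exact simplexRescale_inv (fixWeight_pos h) hx.1
    · rw [← fixWeight_inv B A]
      exact simplexRescale_inv (fixWeight_pos h') hx.1
  have hbij := hinv.bijOn (mapsTo_simplexRescale_fixSet hA hB h)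
    (mapsTo_simplexRescale_fixSet hB hA h')
  rw [← hbij.image_eq, hbij.injOn.ncard_image]

lemma isQSOMatrix_segment {n : Type*} [Fintype n] {A B : Matrix n n ℝ} (hA : IsQSOMatrix A)
    (hB : IsQSOMatrix B) {t : ℝ} (ht : t ∈ Set.Icc (0 : ℝ) 1) :
    IsQSOMatrix ((1 - t) • A + t • B) := by
  refine ⟨?_, fun i j => ?_⟩
  · rw [Matrix.transpose_add, Matrix.transpose_smul, Matrix.transpose_smul, hA.1, hB.1]
    module
  · have ha := abs_le.1 (hA.2 i j)
    have hb := abs_le.1 (hB.2 i j)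
    have h0 := ht.1
    have h1 := sub_nonneg.2 ht.2
    simp only [Matrix.add_apply, Matrix.smul_apply, smul_eq_mul]
    rw [abs_le]
    constructor <;> nlinarith

/-- A continuous function on `[0, 1]` without zeros has endpoint values of the same sign. -/
lemma mul_pos_of_continuousOn_of_ne_zero {f : ℝ → ℝ} (hf : ContinuousOn f (Set.Icc 0 1))
    (hne : ∀ t ∈ Set.Icc (0 : ℝ) 1, f t ≠ 0) : 0 < f 0 * f 1 := by
  by_contra hle
  rw [← Set.uIcc_of_le zero_le_one] at hf hne
  obtain ⟨t, ht, h0⟩ : (0 : ℝ) ∈ f '' Set.uIcc 0 1 := by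
    refine intermediate_value_uIcc hf ?_
    rw [Set.mem_uIcc]
    rcases mul_nonpos_iff.1 (not_lt.1 hle) with h | h
    · exact Or.inr ⟨h.2, h.1⟩
    · exact Or.inl h
  exact hne t ht h0

theorem homotopic_iff_dim_three (A₀ A₁ : Matrix (Fin 3) (Fin 3) ℝ)
    (h₀ : IsQSOMatrix A₀) (h₁ : IsQSOMatrix A₁)
    (t₀ : IsTransversal A₀) (t₁ : IsTransversal A₁) :
    QSOHomotopic A₀ A₁ ↔ ∀ i j : Fin 3, i < j → A₀ i j * A₁ i j > 0 := by
  constructor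
  · rintro ⟨A, hcont, rfl, rfl, hA, -, -⟩ i j hij
    refine mul_pos_of_continuousOn_of_ne_zero (f := fun t => A t i j) ?_ fun t ht => ?_
    · exact (continuous_apply_apply i j).comp_continuousOn hcont
    · exact (hA t ht).1.isTransversal_iff.1 (hA t ht).2 i j hij
  · intro h
    have hseg : ∀ t ∈ Set.Icc (0 : ℝ) 1, ∀ i j : Fin 3, i < j →
        0 < A₀ i j * ((1 - t) • A₀ + t • A₁) i j := by
      intro t ht i j hij
      have hpos := h i j hij
      have hsq : 0 < A₀ i j * A₀ i j := mul_self_pos.2 (left_ne_zero_of_mul hpos.ne')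
      simp only [Matrix.add_apply, Matrix.smul_apply, smul_eq_mul]
      rcases ht.1.eq_or_lt with rfl | ht0
      · simpa using hsq
      · nlinarith [mul_pos ht0 hpos, mul_nonneg (sub_nonneg.2 ht.2) hsq.le]
    refine ⟨fun t => (1 - t) • A₀ + t • A₁, by fun_prop, by simp, by simp, fun t ht => ?_,
      fun t ht => ?_, ncard_fixSet_eq h₀ h₁ h⟩
    · have hq := isQSOMatrix_segment h₀ h₁ ht
      exact ⟨hq, hq.isTransversal_iff.2 fun i j hij =>
        right_ne_zero_of_mul (hseg t ht i j hij).ne'⟩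
    · exact (ncard_fixSet_eq h₀ (isQSOMatrix_segment h₀ h₁ ht) (hseg t ht)).symm
end

section
/- Let A₀, A₁ be transversal real skew-symmetric m×m matrices with entries of absolute value ≤ 1. Then V_{A₀} and V_{A₁} are homotopic if and only if there exists a continuous path γ : [0,1] → ℝ^{m×m} with γ(0) = A₀, γ(1) = A₁, such that for every λ ∈ [0,1] the matrix γ(λ) is skew-symmetric, has entries of absolute value ≤ 1, and is transversal. In other words, two transversal Volterra operators are homotopic if and only if their matrices lie in the same path component of the set of transversal skew-symmetric matrices with entries in [−1,1]. -/
open Matrix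

section Volterra

/-- The principal submatrix of `A` on the index set `s`. -/
abbrev principalSubmatrix {n : Type*} (A : Matrix n n ℝ) (s : Finset n) : Matrix s s ℝ :=
  A.submatrix (fun i : s => (i : n)) (fun i : s => (i : n))

variable {n : Type*} [Fintype n]

theorem mem_fixSet_iff {A : Matrix n n ℝ} {x : n → ℝ} :
    x ∈ FixSet A ↔ x ∈ stdSimplex ℝ n ∧ ∀ k, x k ≠ 0 → (A *ᵥ x) k = 0 := by
  refine and_congr_right fun _ => ?_
  rw [funext_iff]
  refine forall_congr' fun k => ?_
  have h : volterra A x k = x k + x k * (A *ᵥ x) k := by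
    simp only [volterra, mulVec, dotProduct]
    ring
  rw [h, add_eq_left, mul_eq_zero, or_iff_not_imp_left]

theorem principalSubmatrix_mulVec {A : Matrix n n ℝ} {s : Finset n} {x : n → ℝ}
    (hx : ∀ i ∉ s, x i = 0) (k : s) :
    (principalSubmatrix A s *ᵥ fun i => x i) k = (A *ᵥ x) k := by
  simp only [mulVec, dotProduct, submatrix_apply]
  rw [Finset.sum_coe_sort s (fun i => A k i * x i)]
  exact Finset.sum_subset s.subset_univ fun i _ hi => by rw [hx i hi, mul_zero]

/-- The support of a point, as a finset. -/
noncomputable def supp (x : n → ℝ) : Finset n := {i | x i ≠ 0}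

theorem mem_supp {x : n → ℝ} {i : n} : i ∈ supp x ↔ x i ≠ 0 := by simp [supp]

theorem eq_zero_of_notMem_supp {x : n → ℝ} {i : n} (h : i ∉ supp x) : x i = 0 :=
  not_not.1 fun h' => h (mem_supp.2 h')

variable [DecidableEq n]

theorem IsTransversal.eq_zero_of_even {A : Matrix n n ℝ} (hA : IsTransversal A) {s : Finset n}
    (hs : Even s.card) {x : n → ℝ} (hx : ∀ i ∉ s, x i = 0) (hAx : ∀ i ∈ s, (A *ᵥ x) i = 0) :
    x = 0 := by
  have h : (fun i : s => x i) = 0 :=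
    eq_zero_of_mulVec_eq_zero (hA s hs) <| funext fun k =>
      (principalSubmatrix_mulVec hx k).trans (hAx k k.2)
  funext i
  by_cases hi : i ∈ s
  · exact congrFun h ⟨i, hi⟩
  · exact hx i hi

theorem IsTransversal.eq_zero_of_odd {A : Matrix n n ℝ} (hA : IsTransversal A) {s : Finset n}
    (hs : Odd s.card) {k : n} (hk : k ∈ s) {x : n → ℝ} (hx : ∀ i ∉ s, x i = 0) (hxk : x k = 0)
    (hAx : ∀ i ∈ s, i ≠ k → (A *ᵥ x) i = 0) : x = 0 := by
  refine hA.eq_zero_of_even (s := s.erase k) ?_ (fun i hi => ?_) fun i hi => ?_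
  · rw [Finset.card_erase_of_mem hk]
    exact Nat.Odd.sub_odd hs odd_one
  · by_cases h : i = k
    · rwa [h]
    · exact hx i fun his => hi (Finset.mem_erase.2 ⟨h, his⟩)
  · exact hAx i (Finset.mem_of_mem_erase hi) (Finset.ne_of_mem_erase hi)

theorem IsTransversal.principalSubmatrix_eq_zero {A : Matrix n n ℝ} (hA : IsTransversal A)
    {s : Finset n} (hs : Odd s.card) (k : s) {v : s → ℝ} (hvk : v k = 0)
    (hv : ∀ i ≠ k, (principalSubmatrix A s *ᵥ v) i = 0) : v = 0 := by
  set x : n → ℝ := fun i => if h : i ∈ s then v ⟨i, h⟩ else 0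
  have hxs : ∀ i ∉ s, x i = 0 := fun i hi => dif_neg hi
  have hxv : (fun i : s => x i) = v := funext fun i => dif_pos i.2
  have hx0 : x = 0 := by
    refine hA.eq_zero_of_odd hs k.2 hxs ((congrFun hxv k).trans hvk) fun i hi hik => ?_
    rw [← principalSubmatrix_mulVec hxs ⟨i, hi⟩, hxv]
    exact hv _ fun h => hik (congrArg Subtype.val h)
  rw [← hxv, hx0]
  rfl

theorem Matrix.det_eq_zero_of_transpose_eq_neg_of_odd {B : Matrix n n ℝ} (hB : Bᵀ = -B)
    (hn : Odd (Fintype.card n)) : B.det = 0 := by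
  have h := B.det_transpose
  rw [hB, det_neg, hn.neg_one_pow] at h
  linarith

theorem principalSubmatrix_mulVec_adjugate_col {n : Type*} [DecidableEq n] {A : Matrix n n ℝ}
    (hA : Aᵀ = -A) {s : Finset n} (hs : Odd s.card) (k : s) :
    principalSubmatrix A s *ᵥ (fun i => (principalSubmatrix A s).adjugate i k) = 0 := by
  have hskew : (principalSubmatrix A s)ᵀ = -principalSubmatrix A s := by
    ext i j
    exact congrFun (congrFun hA i) j
  have hdet : (principalSubmatrix A s).det = 0 :=
    det_eq_zero_of_transpose_eq_neg_of_odd hskew (by rwa [Fintype.card_coe])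
  funext i
  have h := congrFun (congrFun (mul_adjugate (principalSubmatrix A s)) i) k
  rw [hdet, zero_smul] at h
  exact h

theorem IsTransversal.adjugate_diag_ne_zero {A : Matrix n n ℝ} (hA : IsTransversal A)
    {s : Finset n} (hs : Odd s.card) (k : s) : (principalSubmatrix A s).adjugate k k ≠ 0 := by
  rw [adjugate_apply]
  intro h
  obtain ⟨v, hv, hv0⟩ := exists_mulVec_eq_zero_iff.2 h
  refine hv (hA.principalSubmatrix_eq_zero hs k ?_ fun i hi => ?_)
  · simpa [mulVec] using congrFun hv0 k
  · simpa [mulVec, hi] using congrFun hv0 i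

theorem IsTransversal.adjugate_ne_zero {A : Matrix n n ℝ} (hA : IsTransversal A)
    (hskew : Aᵀ = -A) {s : Finset n} (hs : Odd s.card) (i k : s) :
    (principalSubmatrix A s).adjugate i k ≠ 0 := fun h =>
  hA.adjugate_diag_ne_zero hs k <| congrFun (hA.principalSubmatrix_eq_zero hs i
    (v := fun j => (principalSubmatrix A s).adjugate j k) h fun j _ =>
      congrFun (principalSubmatrix_mulVec_adjugate_col hskew hs k) j) k

theorem IsTransversal.odd_card_supp {A : Matrix n n ℝ} (hA : IsTransversal A) {x : n → ℝ}
    (hx : x ∈ FixSet A) : Odd (supp x).card := by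
  rw [mem_fixSet_iff] at hx
  by_contra h
  have h0 := hA.eq_zero_of_even (Nat.not_odd_iff_even.1 h) (x := x)
    (fun i => eq_zero_of_notMem_supp) fun i hi => hx.2 i (mem_supp.1 hi)
  have h1 := hx.1.2
  simp [h0] at h1

theorem IsTransversal.injOn_supp {A : Matrix n n ℝ} (hA : IsTransversal A) :
    Set.InjOn supp (FixSet A) := by
  intro x hx y hy hxy
  have hs := hA.odd_card_supp hx
  obtain ⟨k, hk⟩ := Finset.card_pos.1 hs.pos
  rw [mem_fixSet_iff] at hx hy
  have h := hA.eq_zero_of_odd hs hk (x := y k • x - x k • y) (fun i hi => ?_) ?_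
    fun i hi _ => ?_
  · have hi : ∀ i, y k * x i = x k * y i := fun i => sub_eq_zero.1 (congrFun h i)
    have hsum : y k = x k := by
      have := Finset.sum_congr rfl fun i (_ : i ∈ Finset.univ) => hi i
      rwa [← Finset.mul_sum, ← Finset.mul_sum, hx.1.2, hy.1.2, mul_one, mul_one] at this
    funext i
    have := hi i
    rw [hsum] at this
    exact mul_left_cancel₀ (mem_supp.1 hk) this
  · have h1 := eq_zero_of_notMem_supp hi
    have h2 := eq_zero_of_notMem_supp (hxy ▸ hi)
    simp [h1, h2]
  · simp [mul_comm]
  · have h1 := hx.2 i (mem_supp.1 hi)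
    have h2 := hy.2 i (mem_supp.1 (hxy ▸ hi))
    simp [mulVec_sub, mulVec_smul, h1, h2]

/-- The supports of the fixed points of a transversal Volterra operator are the index sets of odd
cardinality for which all entries in each column of the adjugate of the corresponding principal
submatrix have the same strict sign. -/
theorem IsTransversal.mem_supp_image_fixSet_iff {A : Matrix n n ℝ} (hA : IsTransversal A)
    (hskew : Aᵀ = -A) {s : Finset n} :
    s ∈ supp '' FixSet A ↔ Odd s.card ∧ ∀ i k : s,
      0 < (principalSubmatrix A s).adjugate i k * (principalSubmatrix A s).adjugate k k := by
  constructor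
  · rintro ⟨x, hx, rfl⟩
    have hs := hA.odd_card_supp hx
    refine ⟨hs, fun i k => ?_⟩
    rw [mem_fixSet_iff] at hx
    have hpos : ∀ i : supp x, 0 < x i := fun i =>
      lt_of_le_of_ne (hx.1.1 i) (mem_supp.1 i.2).symm
    set B := principalSubmatrix A (supp x)
    have hker : (B *ᵥ fun i => x i) = 0 := funext fun i =>
      (principalSubmatrix_mulVec (fun _ => eq_zero_of_notMem_supp) i).trans
        (hx.2 i (mem_supp.1 i.2))
    have hcol : (B *ᵥ fun i => B.adjugate i k) = 0 :=
      principalSubmatrix_mulVec_adjugate_col hskew hs k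
    have h := hA.principalSubmatrix_eq_zero hs k
      (v := x k • (fun i => B.adjugate i k) - B.adjugate k k • fun i : supp x => x i)
      (by simp [mul_comm]) fun j _ => by
        change (B *ᵥ _) j = 0
        rw [mulVec_sub, mulVec_smul, mulVec_smul, hcol, hker]
        simp
    have hi : x k * B.adjugate i k = B.adjugate k k * x i := sub_eq_zero.1 (congrFun h i)
    have hne : B.adjugate k k ≠ 0 := hA.adjugate_diag_ne_zero hs k
    refine pos_of_mul_pos_right (a := x k) ?_ (hpos k).le
    rw [← mul_assoc, hi, mul_right_comm]
    exact mul_pos (mul_self_pos.2 hne) (hpos i)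
  · rintro ⟨hs, hpos⟩
    obtain ⟨k, hk⟩ := Finset.card_pos.1 hs.pos
    set B := principalSubmatrix A s
    set c : s → ℝ := fun i => B.adjugate i ⟨k, hk⟩ * B.adjugate ⟨k, hk⟩ ⟨k, hk⟩
    have hc : ∀ i, 0 < c i := fun i => hpos i _
    have hBc : B *ᵥ c = 0 := by
      have : c = B.adjugate ⟨k, hk⟩ ⟨k, hk⟩ • fun i => B.adjugate i ⟨k, hk⟩ :=
        funext fun i => mul_comm _ _
      rw [this, mulVec_smul, principalSubmatrix_mulVec_adjugate_col hskew hs, smul_zero]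
    set S := ∑ i, c i
    have hS : 0 < S := Finset.sum_pos (fun i _ => hc i) ⟨⟨k, hk⟩, Finset.mem_univ _⟩
    set x : n → ℝ := fun i => if h : i ∈ s then S⁻¹ * c ⟨i, h⟩ else 0
    have hxs : ∀ i ∉ s, x i = 0 := fun i hi => dif_neg hi
    have hxc : ∀ i : s, x i = S⁻¹ * c i := fun i => dif_pos i.2
    have hxpos : ∀ i ∈ s, 0 < x i := fun i hi => by
      rw [hxc ⟨i, hi⟩]
      exact mul_pos (inv_pos.2 hS) (hc _)
    have hmem : ∀ i, i ∈ s ↔ x i ≠ 0 := fun i =>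
      ⟨fun hi => (hxpos i hi).ne', fun h => not_not.1 fun hi => h (hxs i hi)⟩
    refine ⟨x, mem_fixSet_iff.2 ⟨⟨fun i => ?_, ?_⟩, fun i hi => ?_⟩, ?_⟩
    · by_cases hi : i ∈ s
      · exact (hxpos i hi).le
      · exact (hxs i hi).ge
    · rw [← Finset.sum_subset s.subset_univ fun i _ hi => hxs i hi, ← Finset.sum_coe_sort s,
        Finset.sum_congr rfl fun i _ => hxc i, ← Finset.mul_sum]
      exact inv_mul_cancel₀ hS.ne'
    · have hxc' : (fun i : s => x i) = S⁻¹ • c := funext hxc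
      rw [← principalSubmatrix_mulVec hxs ⟨i, (hmem i).2 hi⟩, hxc', mulVec_smul]
      change (S⁻¹ • B *ᵥ c) _ = 0
      rw [hBc, smul_zero]
      rfl
    · ext i
      rw [mem_supp, hmem]

theorem pos_of_continuousOn_of_ne_zero {f : ℝ → ℝ} {I : Set ℝ} (hI : I.OrdConnected)
    (hf : ContinuousOn f I) (h0 : ∀ t ∈ I, f t ≠ 0) {a b : ℝ} (ha : a ∈ I) (hb : b ∈ I)
    (hfa : 0 < f a) : 0 < f b := by
  by_contra! h
  obtain ⟨t, ht, hft⟩ := hI.isPreconnected.intermediate_value hb ha hf ⟨h, hfa.le⟩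
  exact h0 t ht hft

/-- The supports of the fixed points do not change along a path of transversal matrices. -/
theorem supp_image_fixSet_subset_of_path {γ : ℝ → Matrix n n ℝ} {I : Set ℝ}
    (hI : I.OrdConnected) (hγ : ContinuousOn γ I)
    (h : ∀ t ∈ I, IsQSOMatrix (γ t) ∧ IsTransversal (γ t)) {a b : ℝ} (ha : a ∈ I) (hb : b ∈ I) :
    supp '' FixSet (γ a) ⊆ supp '' FixSet (γ b) := by
  intro s hs
  rw [(h a ha).2.mem_supp_image_fixSet_iff (h a ha).1.1] at hs
  rw [(h b hb).2.mem_supp_image_fixSet_iff (h b hb).1.1]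
  refine ⟨hs.1, fun i k => ?_⟩
  have hadj : Continuous fun A : Matrix n n ℝ => (principalSubmatrix A s).adjugate :=
    (continuous_id.matrix_submatrix _ _).matrix_adjugate
  have hcont : Continuous fun A : Matrix n n ℝ =>
      (principalSubmatrix A s).adjugate i k * (principalSubmatrix A s).adjugate k k :=
    (hadj.matrix_elem i k).mul (hadj.matrix_elem k k)
  exact pos_of_continuousOn_of_ne_zero hI (hcont.comp_continuousOn hγ)
    (fun t ht => mul_ne_zero ((h t ht).2.adjugate_ne_zero (h t ht).1.1 hs.1 i k)
      ((h t ht).2.adjugate_diag_ne_zero hs.1 k)) ha hb (hs.2 i k)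

theorem ncard_fixSet_eq_of_path {γ : ℝ → Matrix n n ℝ} {I : Set ℝ}
    (hI : I.OrdConnected) (hγ : ContinuousOn γ I)
    (h : ∀ t ∈ I, IsQSOMatrix (γ t) ∧ IsTransversal (γ t)) {a b : ℝ} (ha : a ∈ I) (hb : b ∈ I) :
    (FixSet (γ a)).ncard = (FixSet (γ b)).ncard := by
  rw [← (h a ha).2.injOn_supp.ncard_image,
    ← (h b hb).2.injOn_supp.ncard_image,
    (supp_image_fixSet_subset_of_path hI hγ h ha hb).antisymm
      (supp_image_fixSet_subset_of_path hI hγ h hb ha)]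

end Volterra

theorem homotopic_iff_path_connected {m : ℕ} (A₀ A₁ : Matrix (Fin m) (Fin m) ℝ)
    (h₀ : IsQSOMatrix A₀) (h₁ : IsQSOMatrix A₁)
    (t₀ : IsTransversal A₀) (t₁ : IsTransversal A₁) :
    QSOHomotopic A₀ A₁ ↔
      ∃ γ : ℝ → Matrix (Fin m) (Fin m) ℝ,
        ContinuousOn γ (Set.Icc 0 1) ∧ γ 0 = A₀ ∧ γ 1 = A₁ ∧
        ∀ t ∈ Set.Icc (0:ℝ) 1, IsQSOMatrix (γ t) ∧ IsTransversal (γ t) := by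
  refine ⟨fun ⟨γ, hγ, hγ₀, hγ₁, h, _⟩ => ⟨γ, hγ, hγ₀, hγ₁, h⟩, fun ⟨γ, hγ, hγ₀, hγ₁, h⟩ => ?_⟩
  have hcard : ∀ t ∈ Set.Icc (0:ℝ) 1, (FixSet (γ t)).ncard = (FixSet A₀).ncard := fun t ht => by
    rw [← hγ₀]
    exact ncard_fixSet_eq_of_path Set.ordConnected_Icc hγ h ht (by simp)
  refine ⟨γ, hγ, hγ₀, hγ₁, h, hcard, ?_⟩
  rw [← hγ₁]
  exact (hcard 1 (by simp)).symm
end
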